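/- arXiv:2307.07279 — 2 statements merged into one kernel-verified Lean document; each statement's English description precedes it below -/
import Mathlib

section
/- Let G be a connected finite simple graph with at least 2 vertices and let v be a vertex of G. Then v is the L-root leaf of some MCS ordering of G if and only if v is not a cut vertex of G. -/
open SimpleGraph

variable {V : Type*}

/-- A generic search (GS) ordering: every vertex other than the first has an
earlier neighbor. -/
def IsGSOrdering [Fintype V] (G : SimpleGraph V) (σ : Fin (Fintype.card V) ≃ V) : Prop :=
  ∀ w : V, (σ.symm w).val ≠ 0 → ∃ u : V, σ.symm u < σ.symm w ∧ G.Adj u w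

/-- DFS ordering (Corneil–Krueger four-point characterization). -/
def IsDFSOrdering [Fintype V] (G : SimpleGraph V) (σ : Fin (Fintype.card V) ≃ V) : Prop :=
  IsGSOrdering G σ ∧ ∀ a b c : V, σ.symm a < σ.symm b → σ.symm b < σ.symm c →
    G.Adj a c → ¬ G.Adj a b →
      ∃ d : V, σ.symm a < σ.symm d ∧ σ.symm d < σ.symm b ∧ G.Adj d b

/-- BFS ordering (Corneil–Krueger four-point characterization). -/
def IsBFSOrdering [Fintype V] (G : SimpleGraph V) (σ : Fin (Fintype.card V) ≃ V) : Prop :=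
  IsGSOrdering G σ ∧ ∀ a b c : V, σ.symm a < σ.symm b → σ.symm b < σ.symm c →
    G.Adj a c → ¬ G.Adj a b →
      ∃ d : V, σ.symm d < σ.symm a ∧ G.Adj d b

/-- LDFS ordering (Corneil–Krueger four-point characterization). -/
def IsLDFSOrdering [Fintype V] (G : SimpleGraph V) (σ : Fin (Fintype.card V) ≃ V) : Prop :=
  IsGSOrdering G σ ∧ ∀ a b c : V, σ.symm a < σ.symm b → σ.symm b < σ.symm c →
    G.Adj a c → ¬ G.Adj a b →
      ∃ d : V, σ.symm a < σ.symm d ∧ σ.symm d < σ.symm b ∧ G.Adj d b ∧ ¬ G.Adj d c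

/-- MNS ordering (Corneil–Krueger four-point characterization). -/
def IsMNSOrdering [Fintype V] (G : SimpleGraph V) (σ : Fin (Fintype.card V) ≃ V) : Prop :=
  IsGSOrdering G σ ∧ ∀ a b c : V, σ.symm a < σ.symm b → σ.symm b < σ.symm c →
    G.Adj a c → ¬ G.Adj a b →
      ∃ d : V, σ.symm d < σ.symm b ∧ G.Adj d b ∧ ¬ G.Adj d c

/-- MCS ordering: for positions `i < j`, the vertex at position `i` has at least as many
neighbors among the vertices at positions `< i` as the vertex at position `j` has. -/
def IsMCSOrdering [Fintype V] (G : SimpleGraph V) (σ : Fin (Fintype.card V) ≃ V) : Prop :=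
  ∀ i j : Fin (Fintype.card V), i < j →
    Nat.card {k : Fin (Fintype.card V) // k < i ∧ G.Adj (σ k) (σ j)} ≤
    Nat.card {k : Fin (Fintype.card V) // k < i ∧ G.Adj (σ k) (σ i)}

/-- A perfect elimination ordering: the earlier neighbors of any vertex form a clique. -/
def IsPEO [Fintype V] (G : SimpleGraph V) (σ : Fin (Fintype.card V) ≃ V) : Prop :=
  ∀ u v w : V, σ.symm u < σ.symm w → σ.symm v < σ.symm w → u ≠ v →
    G.Adj u w → G.Adj v w → G.Adj u v

/-- `u` is the F-parent of `v`: `v` is not the first vertex and `u` is the earliest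
neighbor of `v` in the ordering. -/
def FParent [Fintype V] (G : SimpleGraph V) (σ : Fin (Fintype.card V) ≃ V) (u v : V) : Prop :=
  (σ.symm v).val ≠ 0 ∧ G.Adj u v ∧ ∀ w : V, G.Adj w v → σ.symm u ≤ σ.symm w

/-- `u` is the L-parent of `v`: `v` is not the first vertex and `u` is the last
neighbor of `v` occurring before `v` in the ordering. -/
def LParent [Fintype V] (G : SimpleGraph V) (σ : Fin (Fintype.card V) ≃ V) (u v : V) : Prop :=
  (σ.symm v).val ≠ 0 ∧ G.Adj u v ∧ σ.symm u < σ.symm v ∧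
    ∀ w : V, G.Adj w v → σ.symm w < σ.symm v → σ.symm w ≤ σ.symm u

/-- `v` is an F-branch leaf: `v` is not the first vertex and is the F-parent of no vertex. -/
def FBranchLeaf [Fintype V] (G : SimpleGraph V) (σ : Fin (Fintype.card V) ≃ V) (v : V) : Prop :=
  (σ.symm v).val ≠ 0 ∧ ∀ w : V, ¬ FParent G σ v w

/-- `v` is the F-root leaf: `v` is the first vertex and is the F-parent of exactly one vertex. -/
def FRootLeaf [Fintype V] (G : SimpleGraph V) (σ : Fin (Fintype.card V) ≃ V) (v : V) : Prop :=
  (σ.symm v).val = 0 ∧ ∃! w : V, FParent G σ v w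

/-- `v` is an L-branch leaf: `v` is not the first vertex and is the L-parent of no vertex. -/
def LBranchLeaf [Fintype V] (G : SimpleGraph V) (σ : Fin (Fintype.card V) ≃ V) (v : V) : Prop :=
  (σ.symm v).val ≠ 0 ∧ ∀ w : V, ¬ LParent G σ v w

/-- `v` is the L-root leaf: `v` is the first vertex and is the L-parent of exactly one vertex. -/
def LRootLeaf [Fintype V] (G : SimpleGraph V) (σ : Fin (Fintype.card V) ≃ V) (v : V) : Prop :=
  (σ.symm v).val = 0 ∧ ∃! w : V, LParent G σ v w

/-- `v` is an L-leaf: the L-root leaf or an L-branch leaf. -/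
def LLeaf [Fintype V] (G : SimpleGraph V) (σ : Fin (Fintype.card V) ≃ V) (v : V) : Prop :=
  LRootLeaf G σ v ∨ LBranchLeaf G σ v

/-- `v` is the end-vertex (last vertex) of the ordering `σ`. -/
def IsEndVertex [Fintype V] (σ : Fin (Fintype.card V) ≃ V) (v : V) : Prop :=
  (σ.symm v).val = Fintype.card V - 1

/-- `v` is a cut vertex: deleting `v` yields a disconnected graph. -/
def CutVertex (G : SimpleGraph V) (v : V) : Prop :=
  ¬ (G.induce {w : V | w ≠ v}).Connected

/-- A graph is chordal if every cycle of length at least 4 has a chord, i.e. an edge of the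
graph joining two vertices of the cycle which is not an edge of the cycle. -/
def IsChordal (G : SimpleGraph V) : Prop :=
  ∀ ⦃v : V⦄ (w : G.Walk v v), w.IsCycle → 4 ≤ w.length →
    ∃ x y : V, x ∈ w.support ∧ y ∈ w.support ∧ G.Adj x y ∧ s(x, y) ∉ w.edges

open Classical in
/-- Greedy construction of an ordering. -/
theorem exists_greedy [Fintype V] (f : Finset V → V → ℕ) :
    ∃ σ : Fin (Fintype.card V) ≃ V, ∀ i j : Fin (Fintype.card V), i ≤ j →
      f ((Finset.univ.filter (fun k => k < i)).image σ) (σ j) ≤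
      f ((Finset.univ.filter (fun k => k < i)).image σ) (σ i) := by
  by_cases hV : IsEmpty V
  · refine ⟨(Fintype.equivFin V).symm, fun i => ?_⟩
    exact (hV.false ((Fintype.equivFin V).symm i)).elim
  rw [not_isEmpty_iff] at hV
  have hc : ∀ S : Finset V, ∃ x : V, S ≠ Finset.univ → x ∉ S ∧ ∀ y, y ∉ S → f S y ≤ f S x := by
    intro S
    by_cases hS : S = Finset.univ
    · exact ⟨Classical.arbitrary V, fun h => (h hS).elim⟩
    · have hne : (Sᶜ).Nonempty := by
        rw [Finset.nonempty_iff_ne_empty]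
        intro h
        exact hS (by simpa using h)
      obtain ⟨x, hx, hm⟩ := Finset.exists_max_image Sᶜ (f S) hne
      exact ⟨x, fun _ => ⟨by simpa using hx, fun y hy => hm y (by simpa using hy)⟩⟩
  choose c hc using hc
  let S : ℕ → Finset V := fun n => Nat.rec ∅ (fun _ T => insert (c T) T) n
  have hS0 : S 0 = ∅ := rfl
  have hS1 : ∀ n, S (n+1) = insert (c (S n)) (S n) := fun n => rfl
  have hSim : ∀ n, S n = (Finset.range n).image (fun m => c (S m)) := by
    intro n
    induction n with
    | zero => simp [hS0]
    | succ n ih => rw [hS1, Finset.range_add_one, Finset.image_insert, ← ih]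
  have hne : ∀ n, n < Fintype.card V → S n ≠ Finset.univ := by
    intro n hn h
    have h1 : (S n).card ≤ n := by
      rw [hSim]
      exact Finset.card_image_le.trans (by simp)
    rw [h, Finset.card_univ] at h1
    omega
  let g : Fin (Fintype.card V) → V := fun i => c (S i)
  have hmem : ∀ i j : Fin (Fintype.card V), i < j → g i ∈ S j := by
    intro i j hij
    rw [hSim]
    exact Finset.mem_image.2 ⟨i, by simpa using hij, rfl⟩
  have hnot : ∀ i j : Fin (Fintype.card V), i ≤ j → g j ∉ S i := by
    intro i j hij h
    have h2 : S i ⊆ S j := by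
      rw [hSim i, hSim j]
      apply Finset.image_subset_image
      intro a
      simp only [Finset.mem_range]
      intro ha
      exact lt_of_lt_of_le ha hij
    exact (hc (S j) (hne j j.2)).1 (h2 h)
  have hinj : Function.Injective g := by
    intro i j h
    rcases lt_trichotomy i j with h1 | h1 | h1
    · exact (hnot j j le_rfl (h ▸ hmem i j h1)).elim
    · exact h1
    · exact (hnot i i le_rfl (h ▸ hmem j i h1)).elim
  have hbij : Function.Bijective g := by
    rw [Fintype.bijective_iff_injective_and_card]
    exact ⟨hinj, by simp⟩
  refine ⟨Equiv.ofBijective g hbij, fun i j hij => ?_⟩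
  have him : (Finset.univ.filter (fun k => k < i)).image (Equiv.ofBijective g hbij) = S i := by
    ext x
    simp only [Finset.mem_image, Finset.mem_filter, Finset.mem_univ, true_and,
      Equiv.ofBijective_apply]
    constructor
    · rintro ⟨k, hk, rfl⟩
      exact hmem k i hk
    · intro hx
      rw [hSim] at hx
      obtain ⟨m, hm, rfl⟩ := Finset.mem_image.1 hx
      rw [Finset.mem_range] at hm
      exact ⟨⟨m, hm.trans i.2⟩, hm, rfl⟩
  rw [him]
  exact (hc (S i) (hne i i.2)).2 _ (hnot i j hij)

theorem exists_crossing {W : Type*} (H : SimpleGraph W) (hH : H.Connected) (A : Set W)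
    (a b : W) (ha : a ∈ A) (hb : b ∉ A) : ∃ x y, x ∈ A ∧ y ∉ A ∧ H.Adj x y := by
  obtain ⟨p⟩ := hH.preconnected a b
  obtain ⟨d, _, h1, h2⟩ := p.exists_boundary_dart A ha hb
  exact ⟨d.fst, d.snd, h1, h2, d.adj⟩

theorem mcs_gs [Fintype V] (G : SimpleGraph V) (hG : G.Connected)
    (σ : Fin (Fintype.card V) ≃ V) (h : IsMCSOrdering G σ) : IsGSOrdering G σ := by
  intro w hw
  obtain ⟨x, y, hx, hy, hxy⟩ := exists_crossing G hG {u | σ.symm u < σ.symm w}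
    (σ ⟨0, (Nat.zero_le _).trans_lt (σ.symm w).2⟩) w
    (by simp only [Set.mem_setOf_eq, Equiv.symm_apply_apply, Fin.lt_def]; omega) (by simp)
  simp only [Set.mem_setOf_eq, not_lt] at hx hy
  rcases hy.eq_or_lt with he | hlt
  · have : w = y := σ.symm.injective he
    subst this
    exact ⟨x, hx, hxy⟩
  · have h1 := h _ _ hlt
    have h2 : 0 < Nat.card {k : Fin (Fintype.card V) //
        k < σ.symm w ∧ G.Adj (σ k) (σ (σ.symm y))} := by
      rw [Nat.card_pos_iff]
      exact ⟨⟨⟨σ.symm x, hx, by simpa using hxy⟩⟩, inferInstance⟩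
    obtain ⟨⟨⟨k, hk, hk2⟩⟩, _⟩ := Nat.card_pos_iff.1 (h2.trans_le h1)
    exact ⟨σ k, by simpa using hk, by simpa using hk2⟩

theorem exists_lparent [Fintype V] (G : SimpleGraph V)
    (σ : Fin (Fintype.card V) ≃ V) (h : IsGSOrdering G σ) (w : V) (hw : (σ.symm w).val ≠ 0) :
    ∃ u, LParent G σ u w := by
  classical
  obtain ⟨u, hu, hu2⟩ := h w hw
  obtain ⟨p, hp, hm⟩ := Finset.exists_max_image
    (Finset.univ.filter (fun u => σ.symm u < σ.symm w ∧ G.Adj u w)) σ.symm ⟨u, by simp [hu, hu2]⟩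
  simp only [Finset.mem_filter, Finset.mem_univ, true_and] at hp hm
  exact ⟨p, hw, hp.2, hp.1, fun x h1 h2 => hm x ⟨h2, h1⟩⟩

theorem leaf_connected [Fintype V] (G : SimpleGraph V)
    (σ : Fin (Fintype.card V) ≃ V) (h : IsGSOrdering G σ) (v : V) (hl : LRootLeaf G σ v) :
    (G.induce {w : V | w ≠ v}).Connected := by
  obtain ⟨h0, w, hw, hu⟩ := hl
  have hwv : w ≠ v := by
    rintro rfl
    exact hw.1 h0
  have key : ∀ n : ℕ, ∀ x : V, (hx : x ≠ v) → (σ.symm x).val = n →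
      (G.induce {w : V | w ≠ v}).Reachable ⟨x, hx⟩ ⟨w, hwv⟩ := by
    intro n
    induction n using Nat.strong_induction_on with
    | _ n ih =>
      intro x hx hn
      by_cases hxw : x = w
      · subst hxw
        exact Reachable.refl _
      have hx0 : (σ.symm x).val ≠ 0 := by
        intro hh
        exact hx (σ.symm.injective (Fin.ext (hh.trans h0.symm)))
      obtain ⟨p, hp⟩ := exists_lparent G σ h x hx0
      have hpv : p ≠ v := by
        rintro rfl
        exact hxw (hu x hp)
      have hlt : (σ.symm p).val < n := hn ▸ hp.2.2.1
      have hr := ih _ hlt p hpv rfl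
      refine Reachable.trans (Adj.reachable ?_) hr
      exact hp.2.1.symm
  haveI : Nonempty {w : V | w ≠ v} := ⟨⟨w, hwv⟩⟩
  refine ⟨fun a b => ?_⟩
  exact (key _ a.1 a.2 rfl).trans (key _ b.1 b.2 rfl).symm

theorem connected_leaf [Fintype V] (G : SimpleGraph V)
    (hG : G.Connected) (hn : 2 ≤ Fintype.card V) (v : V)
    (hc : (G.induce {w : V | w ≠ v}).Connected) :
    ∃ σ : Fin (Fintype.card V) ≃ V, IsMCSOrdering G σ ∧ LRootLeaf G σ v := by
  classical
  let f : Finset V → V → ℕ := fun S x =>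
    if S = ∅ then (if x = v then 1 else 0)
    else (S.filter (fun y => G.Adj y x)).card + ((S.erase v).filter (fun y => G.Adj y x)).card
  obtain ⟨σ, hσ⟩ := exists_greedy f
  let z : Fin (Fintype.card V) := ⟨0, by omega⟩
  have hz : ∀ i : Fin (Fintype.card V), i = z ∨ z < i := by
    intro i
    rcases Nat.eq_zero_or_pos i.val with h | h
    · exact Or.inl (Fin.ext h)
    · exact Or.inr h
  have hv : σ.symm v = z := by
    have h1 := hσ z (σ.symm v) (Nat.zero_le _)
    have h2 : (Finset.univ.filter (fun k => k < z)).image σ = ∅ := by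
      ext x
      simp [z, Fin.lt_def]
    simp only [f, h2, Equiv.apply_symm_apply, if_true] at h1
    have h3 : σ z = v := by
      by_contra h
      simp [h] at h1
    rw [← h3, Equiv.symm_apply_apply]
  have hvz : σ z = v := by rw [← hv, Equiv.apply_symm_apply]
  have hcard : ∀ i j : Fin (Fintype.card V),
      Nat.card {k : Fin (Fintype.card V) // k < i ∧ G.Adj (σ k) (σ j)} =
      (((Finset.univ.filter (fun k => k < i)).image σ).filter (fun y => G.Adj y (σ j))).card := by
    intro i j
    rw [Nat.card_eq_fintype_card, Fintype.card_subtype, Finset.filter_image,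
      Finset.card_image_of_injective _ σ.injective, Finset.filter_filter]
  have hnem : ∀ i, z < i → (Finset.univ.filter (fun k => k < i)).image σ ≠ ∅ := by
    intro i hi h
    have : σ z ∈ (Finset.univ.filter (fun k => k < i)).image σ :=
      Finset.mem_image_of_mem _ (by simpa using hi)
    rw [h] at this
    simp at this
  have herase : ∀ (S : Finset V) (x : V),
      ((S.erase v).filter (fun y => G.Adj y x)).card ≤ (S.filter (fun y => G.Adj y x)).card ∧
      (S.filter (fun y => G.Adj y x)).card ≤
        ((S.erase v).filter (fun y => G.Adj y x)).card + 1 := by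
    intro S x
    have : (S.erase v).filter (fun y => G.Adj y x) = (S.filter (fun y => G.Adj y x)).erase v := by
      ext u; simp only [Finset.mem_filter, Finset.mem_erase]; tauto
    rw [this]
    refine ⟨Finset.card_le_card (Finset.erase_subset _ _), ?_⟩
    have := Finset.pred_card_le_card_erase (s := S.filter (fun y => G.Adj y x)) (a := v)
    omega
  have hmcs : IsMCSOrdering G σ := by
    intro i j hij
    rcases hz i with rfl | hi
    · have : IsEmpty {k : Fin (Fintype.card V) // k < z ∧ G.Adj (σ k) (σ j)} :=
        ⟨fun k => absurd k.2.1 (Nat.not_lt_zero _)⟩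
      simp
    · rw [hcard, hcard]
      have h1 := hσ i j hij.le
      simp only [f, if_neg (hnem i hi)] at h1
      have h2 := herase ((Finset.univ.filter (fun k => k < i)).image σ) (σ i)
      have h3 := herase ((Finset.univ.filter (fun k => k < i)).image σ) (σ j)
      omega
  have hgs := mcs_gs G hG σ hmcs
  refine ⟨σ, hmcs, by rw [hv], ?_⟩
  let o : Fin (Fintype.card V) := ⟨1, by omega⟩
  have hzo : z < o := by simp [z, o, Fin.lt_def]
  refine ⟨σ o, ?_, ?_⟩
  · obtain ⟨p, hp⟩ := exists_lparent G σ hgs (σ o) (by simp [o])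
    have : p = v := by
      have h1 := hp.2.2.1
      rw [Equiv.symm_apply_apply] at h1
      have h2 : σ.symm p = z := by
        apply Fin.ext
        have : (σ.symm p).val < 1 := h1
        show _ = 0
        omega
      rw [← hvz, ← h2, Equiv.apply_symm_apply]
    exact this ▸ hp
  · intro w hw
    by_contra hwo
    set i := σ.symm w with hi
    have hwi : w = σ i := by rw [hi, Equiv.apply_symm_apply]
    have hzi : z < i := Nat.pos_of_ne_zero hw.1
    have hoi : o < i := by
      have h1 : i ≠ o := fun h => hwo (by rw [hwi, h])
      have h2 : i.val ≠ 1 := fun h => h1 (Fin.ext h)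
      have h3 : i.val ≠ 0 := hw.1
      show 1 < i.val
      omega
    have hne : ∀ j, z < j → σ j ≠ v := by
      intro j hj h
      rw [← hvz] at h
      exact hj.ne' (σ.injective h)
    obtain ⟨x, y, hx, hy, hxy⟩ := exists_crossing _ hc {u | σ.symm u.1 < i}
      ⟨σ o, hne o hzo⟩ ⟨σ i, hne i hzi⟩ (by simpa using hoi) (by simp)
    simp only [Set.mem_setOf_eq, not_lt] at hx hy
    have hxy' : G.Adj x.1 y.1 := hxy
    have hg := hσ i (σ.symm y.1) hy
    simp only [f, if_neg (hnem i hzi), Equiv.apply_symm_apply] at hg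
    set S := (Finset.univ.filter (fun k => k < i)).image σ with hS
    have hmS : ∀ u, u ∈ S ↔ σ.symm u < i := by
      intro u
      rw [hS, Finset.mem_image]
      constructor
      · rintro ⟨k, hk, rfl⟩
        simpa using hk
      · intro h
        exact ⟨σ.symm u, by simpa using h, by simp⟩
    have h0 : ((S.erase v).filter (fun u => G.Adj u (σ i))).card = 0 := by
      rw [Finset.card_eq_zero, Finset.filter_eq_empty_iff]
      intro u hu ha
      rw [Finset.mem_erase, hmS] at hu
      have := hw.2.2.2 u (hwi ▸ ha) hu.2
      rw [hv] at this
      have h5 : σ.symm u = z := Fin.ext (Nat.le_zero.1 this)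
      exact hu.1 (by rw [← hvz, ← h5, Equiv.apply_symm_apply])
    have h1 : 0 < ((S.erase v).filter (fun u => G.Adj u y.1)).card := by
      rw [Finset.card_pos]
      exact ⟨x.1, by rw [Finset.mem_filter, Finset.mem_erase, hmS]; exact ⟨⟨x.2, hx⟩, hxy'⟩⟩
    have h2 := herase S (σ i)
    have h3 := herase S y.1
    omega

/-- `v` is the L-root leaf of some MCS ordering iff `v` is not a cut vertex. -/
theorem stmt2 [Fintype V] (G : SimpleGraph V)
    (hG : G.Connected) (hn : 2 ≤ Fintype.card V) (v : V) :
    (∃ σ : Fin (Fintype.card V) ≃ V, IsMCSOrdering G σ ∧ LRootLeaf G σ v) ↔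
      ¬ CutVertex G v := by
  unfold CutVertex
  rw [not_not]
  constructor
  · rintro ⟨σ, h1, h2⟩
    exact leaf_connected G σ (mcs_gs G hG σ h1) v h2
  · exact connected_leaf G hG hn v
end

section
/- Let G be a chordal finite simple graph, let r be a vertex of G, and let i be a natural number. If x and y are distinct vertices with dist_G(r,x) = dist_G(r,y) = i, and z is a vertex with dist_G(r,z) = i+1 that is adjacent to both x and y, then x and y are adjacent. -/
open SimpleGraph

variable {V : Type*}

/-- A shortest walk within a vertex set `S` is a path without chords. -/
lemma chordless_of_min (G : SimpleGraph V) (S : V → Prop) {u v : V} (p : G.Walk u v)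
    (hS : ∀ a ∈ p.support, S a)
    (hmin : ∀ q : G.Walk u v, (∀ a ∈ q.support, S a) → p.length ≤ q.length) :
    p.IsPath ∧ ∀ a b : V, a ∈ p.support → b ∈ p.support → G.Adj a b → s(a, b) ∈ p.edges := by
  classical
  induction p with
  | nil =>
    refine ⟨Walk.IsPath.nil, ?_⟩
    intro a b ha hb hab
    simp at ha hb
    subst ha
    subst hb
    exact (G.loopless.irrefl _ hab).elim
  | @cons u w v h p ih =>
    have hSu : S u := hS u (by simp)
    have hSp : ∀ a ∈ p.support, S a := fun a ha => hS a (by simp [ha])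
    obtain ⟨hp, hc⟩ := ih hSp (by
      intro q hq
      have := hmin (Walk.cons h q) (by
        intro a ha
        rw [Walk.support_cons, List.mem_cons] at ha
        rcases ha with rfl | ha
        · exact hSu
        · exact hq a ha)
      simpa using this)
    have key : ∀ b ∈ p.support, G.Adj u b → b = w := by
      intro b hb hub
      by_contra hne
      have h1 := hmin (Walk.cons hub (p.dropUntil b hb)) (by
        intro a ha
        rw [Walk.support_cons, List.mem_cons] at ha
        rcases ha with rfl | ha
        · exact hSu
        · exact hSp a (p.support_dropUntil_subset_support hb ha))
      have h2 := Walk.length_dropUntil_lt_length hb hne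
      simp at h1
      omega
    have hu : u ∉ p.support := by
      intro hu
      have h1 := hmin (p.dropUntil u hu)
        (fun a ha => hSp a (p.support_dropUntil_subset_support hu ha))
      have h2 := p.length_dropUntil_le_length hu
      simp at h1
      omega
    refine ⟨(Walk.cons_isPath_iff h p).2 ⟨hp, hu⟩, ?_⟩
    intro a b ha hb hab
    rw [Walk.support_cons, List.mem_cons] at ha hb
    rw [Walk.edges_cons, List.mem_cons]
    rcases ha with rfl | ha <;> rcases hb with rfl | hb
    · exact (G.loopless.irrefl _ hab).elim
    · left
      rw [key b hb hab]
    · left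
      rw [key a ha hab.symm, Sym2.eq_swap]
    · exact Or.inr (hc a b ha hb hab)

/-- On a shortest walk from `r` to `x`, all vertices but `x` are closer to `r`. -/
lemma geodesic_support (G : SimpleGraph V) (r x : V) (p : G.Walk r x)
    (hp : p.length = G.dist r x) (a : V) (ha : a ∈ p.support) :
    a = x ∨ G.dist r a < G.dist r x := by
  classical
  by_cases h : a = x
  · exact Or.inl h
  · right
    have h1 := Walk.length_takeUntil_lt_length ha h
    have h2 := G.dist_le (p.takeUntil a ha)
    omega

/-- In a chordal graph, if `x ≠ y` lie at distance `i` from `r` and `z` at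
distance `i + 1` from `r` is adjacent to both `x` and `y`, then `x` and `y` are
adjacent. -/
theorem stmt15 [Fintype V] (G : SimpleGraph V) (hch : IsChordal G)
    (r x y z : V) (i : ℕ) (hxy : x ≠ y)
    (hrx : G.Reachable r x) (hry : G.Reachable r y) (hrz : G.Reachable r z)
    (hdx : G.dist r x = i) (hdy : G.dist r y = i) (hdz : G.dist r z = i + 1)
    (hzx : G.Adj z x) (hzy : G.Adj z y) : G.Adj x y := by
  classical
  by_contra hnadj
  let S : V → Prop := fun a => a = x ∨ a = y ∨ G.dist r a < i
  obtain ⟨px, hpx⟩ := hrx.exists_walk_length_eq_dist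
  obtain ⟨py, hpy⟩ := hry.exists_walk_length_eq_dist
  have hex : ∃ n : ℕ, ∃ p : G.Walk x y, (∀ a ∈ p.support, S a) ∧ p.length = n := by
    refine ⟨_, px.reverse.append py, ?_, rfl⟩
    intro a ha
    rw [Walk.mem_support_append_iff, Walk.support_reverse, List.mem_reverse] at ha
    rcases ha with ha | ha
    · rcases geodesic_support G r x px hpx a ha with h | h
      · exact Or.inl h
      · exact Or.inr (Or.inr (hdx ▸ h))
    · rcases geodesic_support G r y py hpy a ha with h | h
      · exact Or.inr (Or.inl h)
      · exact Or.inr (Or.inr (hdy ▸ h))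
  obtain ⟨p, hpS, hpn⟩ := Nat.find_spec hex
  have hmin : ∀ q : G.Walk x y, (∀ a ∈ q.support, S a) → p.length ≤ q.length := by
    intro q hq
    rw [hpn]
    exact Nat.find_min' hex ⟨q, hq, rfl⟩
  obtain ⟨hpath, hchord⟩ := chordless_of_min G S p hpS hmin
  have hz : z ∉ p.support := by
    intro hz
    rcases hpS z hz with h | h | h
    · exact hzx.ne h
    · exact hzy.ne h
    · omega
  have hlen : 2 ≤ p.length := by
    rcases Nat.lt_or_ge p.length 2 with h | h
    · interval_cases hl : p.length
      · exact (hxy (Walk.eq_of_length_eq_zero hl)).elim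
      · exact (hnadj (Walk.adj_of_length_eq_one hl)).elim
    · exact h
  have hzadj : ∀ b ∈ p.support, G.Adj z b → b = x ∨ b = y := by
    intro b hb hzb
    rcases hpS b hb with h | h | h
    · exact Or.inl h
    · exact Or.inr h
    · have := hzb.diff_dist_adj (u := r)
      omega
  have hcyc : (Walk.cons hzx (p.concat hzy.symm)).IsCycle := by
    rw [Walk.cons_isCycle_iff]
    refine ⟨hpath.concat hz hzy.symm, ?_⟩
    rw [Walk.edges_concat, List.concat_eq_append, List.mem_append, List.mem_singleton]
    rintro (h | h)
    · exact hz (p.fst_mem_support_of_mem_edges h)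
    · rw [Sym2.eq_swap (a := y), Sym2.congr_right] at h
      exact hxy h
  obtain ⟨a, b, ha, hb, hab, hne⟩ := hch _ hcyc (by simp; omega)
  simp only [Walk.support_cons, Walk.support_concat, Walk.edges_cons, Walk.edges_concat,
    List.concat_eq_append, List.mem_append, List.mem_cons, List.not_mem_nil, or_false,
    not_or] at ha hb hne
  obtain ⟨hn1, hn2, hn3⟩ := hne
  have ha' : a = z ∨ a ∈ p.support := by tauto
  have hb' : b = z ∨ b ∈ p.support := by tauto
  rcases ha' with rfl | ha' <;> rcases hb' with rfl | hb'
  · exact G.loopless.irrefl _ hab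
  · rcases hzadj b hb' hab with rfl | rfl
    · exact hn1 rfl
    · exact hn3 Sym2.eq_swap
  · rcases hzadj a ha' hab.symm with rfl | rfl
    · exact hn1 Sym2.eq_swap
    · exact hn3 rfl
  · exact hn2 (hchord a b ha' hb' hab)
end
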